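/- Let S from H₀ to H₁ and T from H₁ to H₂ be closed densely defined operators between complex Hilbert spaces with range S ⊆ ker T (a Hilbert complex). Then the following are equivalent: (a) there exists C > 0 such that C‖x‖² ≤ ‖S†x‖² + ‖Tx‖² for all x ∈ D(S†) ∩ D(T) that are orthogonal to ker T ∩ ker S†; (b) the range of S is closed in H₁ and the range of T is closed in H₂. -/

import Mathlib

/-!
STATEMENT 5: Let S : H₀ → H₁ and T : H₁ → H₂ be closed densely defined operators between
complex Hilbert spaces with range S ⊆ ker T (a Hilbert complex). Then the following are
equivalent:
(a) there exists C > 0 such that C‖x‖² ≤ ‖S†x‖² + ‖Tx‖² for all x ∈ D(S†) ∩ D(T) that are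
    orthogonal to ker T ∩ ker S†;
(b) the range of S is closed in H₁ and the range of T is closed in H₂.
-/

noncomputable section

/-- The kernel of a partially defined operator, as a submodule of the ambient space. -/
def pKer {R E F : Type*} [Ring R] [AddCommGroup E] [Module R E] [AddCommGroup F] [Module R F]
    (P : E →ₗ.[R] F) : Submodule R E :=
  (LinearMap.ker P.toFun).map P.domain.subtype

/-- The range of a partially defined operator. -/
def pRan {R E F : Type*} [Ring R] [AddCommGroup E] [Module R E] [AddCommGroup F] [Module R F]
    (P : E →ₗ.[R] F) : Submodule R F :=
  LinearMap.range P.toFun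

section PartialOperators

variable {𝕜 E F : Type*} [RCLike 𝕜]
  [NormedAddCommGroup E] [InnerProductSpace 𝕜 E] [NormedAddCommGroup F] [InnerProductSpace 𝕜 F]

theorem mem_pKer_iff {P : E →ₗ.[𝕜] F} {x : E} :
    x ∈ pKer P ↔ ∃ h : x ∈ P.domain, P ⟨x, h⟩ = 0 := by
  constructor
  · rintro ⟨y, hy, rfl⟩
    exact ⟨y.2, hy⟩
  · rintro ⟨h, hx⟩
    exact ⟨⟨x, h⟩, hx, rfl⟩

theorem mem_pKer_iff_mem_graph {P : E →ₗ.[𝕜] F} {x : E} :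
    x ∈ pKer P ↔ (x, (0 : F)) ∈ P.graph := by
  rw [mem_pKer_iff, LinearPMap.mem_graph_iff]
  constructor
  · rintro ⟨h, hx⟩
    exact ⟨⟨x, h⟩, rfl, hx⟩
  · rintro ⟨y, rfl, hy⟩
    exact ⟨y.2, hy⟩

theorem mem_pRan_iff {P : E →ₗ.[𝕜] F} {y : F} : y ∈ pRan P ↔ ∃ x : P.domain, P x = y :=
  Iff.rfl

theorem isClosed_pKer {P : E →ₗ.[𝕜] F} (hP : P.IsClosed) : IsClosed (pKer P : Set E) := by
  have h : (pKer P : Set E) = (fun x : E => (x, (0 : F))) ⁻¹' (P.graph : Set (E × F)) := by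
    ext x
    exact mem_pKer_iff_mem_graph
  rw [h]
  exact IsClosed.preimage (by fun_prop) hP

theorem exists_mem_orthogonal_pKer_apply_eq [CompleteSpace E] {P : E →ₗ.[𝕜] F}
    (hP : P.IsClosed) (x : P.domain) :
    ∃ y : P.domain, (y : E) ∈ (pKer P)ᗮ ∧ P y = P x ∧ ‖(y : E)‖ ≤ ‖(x : E)‖ := by
  have : CompleteSpace (pKer P) := (isClosed_pKer hP).completeSpace_coe
  obtain ⟨k, hk, z, hz, hxz⟩ := (pKer P).exists_add_mem_mem_orthogonal (x : E)
  obtain ⟨hkd, hk0⟩ := mem_pKer_iff.1 hk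
  have hzx : z = ((x - ⟨k, hkd⟩ : P.domain) : E) := by
    simp [hxz]
  refine ⟨x - ⟨k, hkd⟩, hzx ▸ hz, by rw [LinearPMap.map_sub, hk0, sub_zero], ?_⟩
  rw [← hzx]
  have hpyth := norm_add_sq_eq_norm_sq_add_norm_sq_of_inner_eq_zero k z (𝕜 := 𝕜) (hz k hk)
  rw [← hxz] at hpyth
  exact le_of_sq_le_sq (by nlinarith [norm_nonneg k]) (norm_nonneg _)

/-- A closed operator that is bounded below on the orthogonal complement of its kernel has closed
range. -/
theorem isClosed_pRan_of_norm_le [CompleteSpace E] [CompleteSpace F] {P : E →ₗ.[𝕜] F}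
    (hP : P.IsClosed) {K : ℝ} (hK : 0 ≤ K)
    (h : ∀ x : P.domain, (x : E) ∈ (pKer P)ᗮ → ‖(x : E)‖ ≤ K * ‖P x‖) :
    IsClosed (pRan P : Set F) := by
  let G : Submodule 𝕜 (E × F) := P.graph ⊓ (pKer P)ᗮ.comap (LinearMap.fst 𝕜 E F)
  have hG : IsClosed (G : Set (E × F)) :=
    IsClosed.inter hP ((pKer P).isClosed_orthogonal.preimage continuous_fst)
  have : CompleteSpace G := hG.completeSpace_coe
  let f : G →L[𝕜] F := (ContinuousLinearMap.snd 𝕜 E F).comp G.subtypeL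
  have hf : AntilipschitzWith (Real.toNNReal (K + 1)) f := by
    refine AddMonoidHomClass.antilipschitz_of_bound f fun g => ?_
    rw [Real.coe_toNNReal _ (by positivity)]
    obtain ⟨⟨a, b⟩, hg, ha⟩ := g
    obtain ⟨x, rfl, rfl⟩ := (LinearPMap.mem_graph_iff P).1 hg
    have hx := h x ha
    change max ‖(x : E)‖ ‖P x‖ ≤ (K + 1) * ‖P x‖
    have := norm_nonneg (P x)
    exact max_le (by nlinarith) (by nlinarith)
  convert hf.isClosed_range f.uniformContinuous
  ext y
  constructor
  · rintro ⟨x, rfl⟩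
    obtain ⟨z, hz, hzx, -⟩ := exists_mem_orthogonal_pKer_apply_eq hP x
    exact ⟨⟨(z, P z), P.mem_graph z, hz⟩, hzx⟩
  · rintro ⟨⟨⟨a, b⟩, hg, ha⟩, rfl⟩
    obtain ⟨x, rfl, rfl⟩ := (LinearPMap.mem_graph_iff P).1 hg
    exact ⟨x, rfl⟩

/-- A closed operator with closed range is bounded below on the orthogonal complement of its
kernel. -/
theorem exists_norm_le_of_isClosed_pRan [CompleteSpace E] [CompleteSpace F] {P : E →ₗ.[𝕜] F}
    (hP : P.IsClosed) (hR : IsClosed (pRan P : Set F)) :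
    ∃ K : ℝ, 0 < K ∧ ∀ x : P.domain, (x : E) ∈ (pKer P)ᗮ → ‖(x : E)‖ ≤ K * ‖P x‖ := by
  have : CompleteSpace P.graph := completeSpace_coe_iff_isComplete.2 (IsClosed.isComplete hP)
  have : CompleteSpace (pRan P) := hR.completeSpace_coe
  let f : P.graph →L[𝕜] pRan P :=
    ((ContinuousLinearMap.snd 𝕜 E F).comp P.graph.subtypeL).codRestrict (pRan P) (by
      rintro ⟨⟨a, b⟩, hg⟩
      obtain ⟨x, rfl, rfl⟩ := (LinearPMap.mem_graph_iff P).1 hg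
      exact ⟨x, rfl⟩)
  have hf : Function.Surjective f := by
    rintro ⟨_, x, rfl⟩
    exact ⟨⟨_, P.mem_graph x⟩, rfl⟩
  obtain ⟨K, hK, h⟩ := f.exists_preimage_norm_le hf
  refine ⟨K, hK, fun x hx => ?_⟩
  obtain ⟨⟨⟨a, b⟩, hg⟩, hgx, hn⟩ := h ⟨P x, x, rfl⟩
  obtain ⟨z, rfl, rfl⟩ := (LinearPMap.mem_graph_iff P).1 hg
  have hzx : P z = P x := congrArg Subtype.val hgx
  have hker : (z - x : E) ∈ pKer P :=
    mem_pKer_iff.2 ⟨(z - x).2, by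
      change P (z - x) = 0
      rw [LinearPMap.map_sub, hzx, sub_self]⟩
  have hpyth := norm_add_sq_eq_norm_sq_add_norm_sq_of_inner_eq_zero (z - x : E) x (𝕜 := 𝕜)
    (hx _ hker)
  rw [sub_add_cancel] at hpyth
  have hxz : ‖(x : E)‖ ≤ ‖(z : E)‖ :=
    le_of_sq_le_sq (by nlinarith [norm_nonneg (z - x : E)]) (norm_nonneg _)
  exact hxz.trans ((le_max_left _ _).trans hn)

theorem pKer_adjoint [CompleteSpace E] {P : E →ₗ.[𝕜] F} (hd : Dense (P.domain : Set E)) :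
    pKer P.adjoint = (pRan P)ᗮ := by
  ext y
  rw [mem_pKer_iff, Submodule.mem_orthogonal']
  constructor
  · rintro ⟨hy, hy0⟩ _ ⟨x, rfl⟩
    have := LinearPMap.adjoint_isFormalAdjoint hd ⟨y, hy⟩ x
    rw [hy0, inner_zero_left] at this
    exact this.symm
  · intro h
    have h0 : ∀ x : P.domain, inner 𝕜 (0 : E) (x : E) = inner 𝕜 y (P x) := fun x => by
      rw [inner_zero_left]
      exact (h _ ⟨x, rfl⟩).symm
    have hy := LinearPMap.mem_adjoint_domain_of_exists y ⟨0, h0⟩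
    exact ⟨hy, LinearPMap.adjoint_apply_eq hd ⟨y, hy⟩ h0⟩

theorem orthogonal_pRan_adjoint_le [CompleteSpace E] [CompleteSpace F] {P : E →ₗ.[𝕜] F}
    (hd : Dense (P.domain : Set E)) (hP : P.IsClosed) : (pRan P.adjoint)ᗮ ≤ pKer P := by
  intro z hz
  let G : Submodule 𝕜 (WithLp 2 (E × F)) :=
    P.graph.comap (WithLp.linearEquiv 2 𝕜 (E × F)).toLinearMap
  have hG : IsClosed (G : Set (WithLp 2 (E × F))) :=
    IsClosed.preimage (WithLp.prod_continuous_ofLp 2 E F) hP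
  have : CompleteSpace G := hG.completeSpace_coe
  suffices h : WithLp.toLp 2 (z, (0 : F)) ∈ Gᗮᗮ by
    rw [Submodule.orthogonal_orthogonal] at h
    exact mem_pKer_iff_mem_graph.2 h
  rintro ⟨a, b⟩ hab
  have h0 : ∀ x : P.domain, inner 𝕜 (-a) (x : E) = inner 𝕜 b (P x) := fun x => by
    have := (Submodule.mem_orthogonal' _ _).1 hab (WithLp.toLp 2 ((x : E), P x)) (P.mem_graph x)
    rw [WithLp.prod_inner_apply] at this
    rw [inner_neg_left]
    exact neg_eq_of_add_eq_zero_right this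
  have hb := LinearPMap.mem_adjoint_domain_of_exists b ⟨-a, h0⟩
  have hz' := hz _ ⟨⟨b, hb⟩, LinearPMap.adjoint_apply_eq hd ⟨b, hb⟩ h0⟩
  rw [inner_neg_left, neg_eq_zero] at hz'
  simp [WithLp.prod_inner_apply, hz']

/-- If the adjoint of a closed densely defined operator has closed range, then so does the
operator. -/
theorem isClosed_pRan_of_isClosed_pRan_adjoint [CompleteSpace E] [CompleteSpace F]
    {P : E →ₗ.[𝕜] F} (hd : Dense (P.domain : Set E)) (hP : P.IsClosed)
    (hR : IsClosed (pRan P.adjoint : Set E)) : IsClosed (pRan P : Set F) := by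
  have hadj := LinearPMap.adjoint_isClosed hd
  obtain ⟨K, hK, h⟩ := exists_norm_le_of_isClosed_pRan hadj hR
  have : CompleteSpace (pRan P.adjoint) := hR.completeSpace_coe
  refine isClosed_pRan_of_norm_le hP hK.le fun w hw => ?_
  have hwR : (w : E) ∈ pRan P.adjoint := by
    rw [← Submodule.orthogonal_orthogonal (pRan P.adjoint)]
    exact Submodule.orthogonal_le (orthogonal_pRan_adjoint_le hd hP) hw
  obtain ⟨y, hy⟩ := mem_pRan_iff.1 hwR
  obtain ⟨x, hx, hxy, -⟩ := exists_mem_orthogonal_pKer_apply_eq hadj y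
  rw [hy] at hxy
  have hxw := h x hx
  rw [hxy] at hxw
  have hinner := LinearPMap.adjoint_isFormalAdjoint hd x w
  rw [hxy] at hinner
  have hsq : ‖(w : E)‖ * ‖(w : E)‖ ≤ K * ‖P w‖ * ‖(w : E)‖ := by
    calc ‖(w : E)‖ * ‖(w : E)‖ = ‖inner 𝕜 (x : F) (P w)‖ := by
          rw [← hinner, inner_self_eq_norm_sq_to_K]; simp [sq]
      _ ≤ ‖(x : F)‖ * ‖P w‖ := norm_inner_le_norm _ _
      _ ≤ K * ‖(w : E)‖ * ‖P w‖ := by gcongr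
      _ = K * ‖P w‖ * ‖(w : E)‖ := by ring
  rcases (norm_nonneg (w : E)).eq_or_lt with h0 | h0
  · rw [← h0]; positivity
  · exact le_of_mul_le_mul_right hsq h0

/-- If a closed densely defined operator `P` has closed range, then the component of `x` in the
range of `P` is controlled by the adjoint of `P` at `x`. -/
theorem exists_norm_le_adjoint_of_isClosed_pRan [CompleteSpace E] [CompleteSpace F]
    {P : E →ₗ.[𝕜] F} (hd : Dense (P.domain : Set E)) (hP : P.IsClosed)
    (hR : IsClosed (pRan P : Set F)) :
    ∃ K : ℝ, 0 < K ∧ ∀ (x : P.adjoint.domain) (u v : F), u ∈ pRan P → v ∈ (pRan P)ᗮ →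
      (x : F) = u + v → ‖u‖ ≤ K * ‖P.adjoint x‖ := by
  obtain ⟨K, hK, h⟩ := exists_norm_le_of_isClosed_pRan hP hR
  refine ⟨K, hK, fun x u v hu hv hxuv => ?_⟩
  obtain ⟨w', rfl⟩ := mem_pRan_iff.1 hu
  obtain ⟨w, hw, hww', -⟩ := exists_mem_orthogonal_pKer_apply_eq hP w'
  rw [← hww'] at hu hxuv ⊢
  have hinner := LinearPMap.adjoint_isFormalAdjoint hd x w
  rw [hxuv, inner_add_left, (Submodule.mem_orthogonal' _ _).1 hv _ hu, add_zero] at hinner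
  have hsq : ‖P w‖ * ‖P w‖ ≤ K * ‖P.adjoint x‖ * ‖P w‖ := by
    calc ‖P w‖ * ‖P w‖ = ‖inner 𝕜 (P.adjoint x) (w : E)‖ := by
          rw [hinner, inner_self_eq_norm_sq_to_K]; simp [sq]
      _ ≤ ‖P.adjoint x‖ * ‖(w : E)‖ := norm_inner_le_norm _ _
      _ ≤ ‖P.adjoint x‖ * (K * ‖P w‖) := by gcongr; exact h w hw
      _ = K * ‖P.adjoint x‖ * ‖P w‖ := by ring
  rcases (norm_nonneg (P w)).eq_or_lt with h0 | h0
  · rw [← h0]; positivity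
  · exact le_of_mul_le_mul_right hsq h0

end PartialOperators

theorem spectral_gap_iff_closed_ranges
    {H₀ H₁ H₂ : Type*}
    [NormedAddCommGroup H₀] [InnerProductSpace ℂ H₀] [CompleteSpace H₀]
    [NormedAddCommGroup H₁] [InnerProductSpace ℂ H₁] [CompleteSpace H₁]
    [NormedAddCommGroup H₂] [InnerProductSpace ℂ H₂] [CompleteSpace H₂]
    (S : H₀ →ₗ.[ℂ] H₁) (T : H₁ →ₗ.[ℂ] H₂)
    (hSd : Dense (S.domain : Set H₀)) (hSc : S.IsClosed)
    (hTd : Dense (T.domain : Set H₁)) (hTc : T.IsClosed)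
    (hST : pRan S ≤ pKer T) :
    (∃ C : ℝ, 0 < C ∧ ∀ (x : H₁) (hxS : x ∈ S.adjoint.domain) (hxT : x ∈ T.domain),
        x ∈ (pKer T ⊓ pKer S.adjoint)ᗮ →
          C * ‖x‖ ^ 2 ≤ ‖S.adjoint ⟨x, hxS⟩‖ ^ 2 + ‖T ⟨x, hxT⟩‖ ^ 2) ↔
      (IsClosed ((pRan S : Submodule ℂ H₁) : Set H₁) ∧
        IsClosed ((pRan T : Submodule ℂ H₂) : Set H₂)) := by
  have hkerS := pKer_adjoint hSd
  constructor
  · rintro ⟨C, hC, h⟩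
    have hbound : ∀ a b : ℝ, 0 ≤ b → C * a ^ 2 ≤ b ^ 2 → a ≤ (√C)⁻¹ * b := fun a b hb hab => by
      have hs := Real.sqrt_pos.2 hC
      rw [inv_mul_eq_div, le_div_iff₀ hs]
      refine le_of_sq_le_sq ?_ hb
      rw [mul_pow, Real.sq_sqrt hC.le]
      linarith
    constructor
    · refine isClosed_pRan_of_isClosed_pRan_adjoint hSd hSc ?_
      refine isClosed_pRan_of_norm_le (LinearPMap.adjoint_isClosed hSd)
        (inv_nonneg.2 (Real.sqrt_nonneg C)) fun x hx => hbound _ _ (norm_nonneg _) ?_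
      have hxT : (x : H₁) ∈ pKer T := by
        rw [hkerS, Submodule.orthogonal_orthogonal_eq_closure] at hx
        exact Submodule.topologicalClosure_minimal _ hST (isClosed_pKer hTc) hx
      obtain ⟨hxd, hx0⟩ := mem_pKer_iff.1 hxT
      have := h x x.2 hxd (Submodule.orthogonal_le inf_le_right hx)
      simpa [hx0] using this
    · refine isClosed_pRan_of_norm_le hTc
        (inv_nonneg.2 (Real.sqrt_nonneg C)) fun x hx => hbound _ _ (norm_nonneg _) ?_
      have hxS : (x : H₁) ∈ pKer S.adjoint := hkerS ▸ Submodule.orthogonal_le hST hx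
      obtain ⟨hxd, hx0⟩ := mem_pKer_iff.1 hxS
      have := h x hxd x.2 (Submodule.orthogonal_le inf_le_left hx)
      simpa [hx0] using this
  · rintro ⟨hS, hT⟩
    obtain ⟨K, hK, hKS⟩ := exists_norm_le_adjoint_of_isClosed_pRan hSd hSc hS
    obtain ⟨L, hL, hLT⟩ := exists_norm_le_of_isClosed_pRan hTc hT
    have : CompleteSpace (pRan S) := hS.completeSpace_coe
    refine ⟨(K ^ 2 + L ^ 2)⁻¹, by positivity, fun x hxS hxT hx => ?_⟩
    obtain ⟨u, hu, v, hv, hxuv⟩ := (pRan S).exists_add_mem_mem_orthogonal x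
    obtain ⟨hud, hu0⟩ := mem_pKer_iff.1 (hST hu)
    have hvx : v = ((⟨x, hxT⟩ - ⟨u, hud⟩ : T.domain) : H₁) := by simp [hxuv]
    have hvT : v ∈ (pKer T)ᗮ := by
      intro k hk
      obtain ⟨a, ha, b, hb, rfl⟩ := (pRan S).exists_add_mem_mem_orthogonal k
      have hbT : b ∈ pKer T := by simpa using sub_mem hk (hST ha)
      have hbx : inner ℂ b x = 0 := hx b ⟨hbT, hkerS ▸ hb⟩
      rw [hxuv, inner_add_right, (Submodule.mem_orthogonal' _ _).1 hb u hu, zero_add] at hbx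
      rw [inner_add_left, hv a ha, hbx, add_zero]
    have hu' := hKS ⟨x, hxS⟩ u v hu hv hxuv
    have hv' := hLT (⟨x, hxT⟩ - ⟨u, hud⟩) (hvx ▸ hvT)
    rw [← hvx, LinearPMap.map_sub, hu0, sub_zero] at hv'
    have hpyth := norm_add_sq_eq_norm_sq_add_norm_sq_of_inner_eq_zero u v (𝕜 := ℂ) (hv u hu)
    rw [← hxuv] at hpyth
    rw [inv_mul_le_iff₀ (by positivity)]
    have hu2 := pow_le_pow_left₀ (norm_nonneg _) hu' 2
    have hv2 := pow_le_pow_left₀ (norm_nonneg _) hv' 2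
    rw [mul_pow] at hu2 hv2
    nlinarith [mul_nonneg (sq_nonneg K) (sq_nonneg ‖T ⟨x, hxT⟩‖),
      mul_nonneg (sq_nonneg L) (sq_nonneg ‖S.adjoint ⟨x, hxS⟩‖)]
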